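/- For every integer n ≥ 1, the number of ascent sequences of length n that avoid both of the patterns 0122 and 1032 equals the Catalan number C_n = (1/(n+1))·binom(2n,n). -/

import Mathlib

/-- The number of ascents of a word of nonnegative integers. -/
def numAscents (w : List ℕ) : ℕ :=
  (w.zip w.tail).countP (fun p => p.1 < p.2)

/-- A word of nonnegative integers is an ascent sequence if it starts with 0 and
each subsequent entry is at most one more than the number of ascents preceding it. -/
def IsAscentSeq (w : List ℕ) : Prop :=
  w.head? = some 0 ∧
    ∀ i (h : i < w.length), 1 ≤ i → w.get ⟨i, h⟩ ≤ numAscents (w.take i) + 1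

/-- A word `π` contains the pattern `τ` if it has a subsequence order-isomorphic to `τ`. -/
def Contains (π τ : List ℕ) : Prop :=
  ∃ f : Fin τ.length → Fin π.length, StrictMono f ∧
    ∀ i j, (π.get (f i) < π.get (f j) ↔ τ.get i < τ.get j) ∧
      (π.get (f i) > π.get (f j) ↔ τ.get i > τ.get j)

/-- A word avoids a pattern if it does not contain it. -/
def Avoids (π τ : List ℕ) : Prop := ¬ Contains π τ

/-- The number of ascent sequences of length `n` avoiding every pattern in `T`. -/
noncomputable def avoiderCount (n : ℕ) (T : List (List ℕ)) : ℕ :=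
  {w : List ℕ | w.length = n ∧ IsAscentSeq w ∧ ∀ τ ∈ T, Avoids w τ}.ncard

section PowerSeriesIdentities

open PowerSeries

/-- The generating function of the Catalan numbers. -/
noncomputable def catalanGF : ℤ⟦X⟧ := PowerSeries.mk fun n => (catalan n : ℤ)

theorem catalanGF_eq : catalanGF = 1 + X * catalanGF ^ 2 := by
  ext n
  rcases n with _ | n
  · simp [catalanGF]
  · rw [map_add, coeff_succ_X_mul, sq, coeff_mul]
    simp [catalanGF, catalan_succ', coeff_one]

/-- The ratio between the generating functions of consecutive slack values. -/
noncomputable def slackRatio : ℤ⟦X⟧ := 1 + X * catalanGF ^ 3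

theorem X_mul_sum_slackRatio (s : ℕ) :
    X * ∑ i ∈ Finset.range s, catalanGF ^ 3 * slackRatio ^ i = slackRatio ^ s - 1 := by
  rw [← geom_sum_mul, ← Finset.mul_sum, slackRatio]
  ring

theorem zeroEnding_series_eq (s : ℕ) :
    catalanGF ^ 2 * slackRatio ^ s = 1 + X * (catalanGF ^ 2 * slackRatio ^ s +
      (catalanGF ^ 3 * slackRatio ^ s +
        ∑ i ∈ Finset.range s, catalanGF ^ 3 * slackRatio ^ i)) := by
  have h := X_mul_sum_slackRatio s
  have hc := catalanGF_eq
  rw [mul_add, mul_add, h]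
  linear_combination slackRatio ^ s * (1 + catalanGF) * hc

theorem nonzeroEnding_series_eq (s : ℕ) :
    catalanGF ^ 3 * slackRatio ^ s = 1 + X * (catalanGF ^ 2 * slackRatio ^ (s + 1) +
      (catalanGF ^ 3 * slackRatio ^ s +
        ∑ i ∈ Finset.range (s + 1), catalanGF ^ 3 * slackRatio ^ i)) := by
  have h := X_mul_sum_slackRatio (s + 1)
  have hc := catalanGF_eq
  have hr : slackRatio = 1 + X * catalanGF ^ 3 := rfl
  rw [mul_add, mul_add, h]
  linear_combination
    slackRatio ^ s * (X * catalanGF ^ 3 + catalanGF ^ 2 + catalanGF + 1) * hc -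
      slackRatio ^ s * (X * catalanGF ^ 2 + 1) * hr

theorem coeff_catalanGF_sq (m : ℕ) : coeff m (catalanGF ^ 2) = (catalan (m + 1) : ℤ) := by
  have h := congrArg (coeff (m + 1)) catalanGF_eq
  rw [map_add, coeff_succ_X_mul] at h
  simpa [catalanGF, coeff_one] using h.symm

end PowerSeriesIdentities

section Words

theorem numAscents_cons_cons (a b : ℕ) (l : List ℕ) :
    numAscents (a :: b :: l) = numAscents (b :: l) + if a < b then 1 else 0 := by
  simp [numAscents, List.countP_cons]

theorem numAscents_concat {p : List ℕ} (hp : p ≠ []) (x : ℕ) :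
    numAscents (p ++ [x]) = numAscents p + if p.getLastD 0 < x then 1 else 0 := by
  induction p with
  | nil => exact absurd rfl hp
  | cons a l ih =>
    rcases l with _ | ⟨b, l⟩
    · simp [numAscents, List.countP_cons]
    · have := ih (by simp)
      simp only [List.cons_append] at this ⊢
      rw [numAscents_cons_cons, this, numAscents_cons_cons]
      simp only [List.getLastD_cons]
      omega

theorem isAscentSeq_concat {p : List ℕ} (hp : p ≠ []) (x : ℕ) :
    IsAscentSeq (p ++ [x]) ↔ IsAscentSeq p ∧ x ≤ numAscents p + 1 := by
  have hpos := List.length_pos_iff.mpr hp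
  unfold IsAscentSeq
  rw [List.head?_append_of_ne_nil _ hp, and_assoc]
  refine and_congr_right fun _ => ⟨fun h => ⟨fun i hi h1 => ?_, ?_⟩, fun ⟨h, hx⟩ i hi h1 => ?_⟩
  · have := h i (by simp; omega) h1
    simpa [List.getElem_append_left hi, List.take_append_of_le_length hi.le] using this
  · simpa using h p.length (by simp) hpos
  · rcases Nat.lt_or_ge i p.length with hlt | hge
    · simpa [List.getElem_append_left hlt, List.take_append_of_le_length hlt.le]
        using h i hlt h1
    · obtain rfl : i = p.length := by simp at hi; omega
      simpa using hx

theorem IsAscentSeq.ne_nil {p : List ℕ} (h : IsAscentSeq p) : p ≠ [] := by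
  rintro rfl
  simp [IsAscentSeq] at h

theorem isAscentSeq_singleton (x : ℕ) : IsAscentSeq [x] ↔ x = 0 := by
  simp only [IsAscentSeq, List.head?_cons, Option.some.injEq, List.length_singleton]
  exact ⟨fun h => h.1, fun h => ⟨h, fun i _ _ => by omega⟩⟩

theorem IsAscentSeq.of_append {p q : List ℕ} (hp : p ≠ []) (h : IsAscentSeq (p ++ q)) :
    IsAscentSeq p := by
  induction q using List.reverseRecOn with
  | nil => simpa using h
  | append_singleton q x ih =>
    rw [← List.append_assoc, isAscentSeq_concat (by simp [hp])] at h
    exact ih h.1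

/-- Every entry that is at least `2` exceeds all the entries before it. -/
def LargeIncreasing (p : List ℕ) : Prop := p.Pairwise fun x y => 2 ≤ y → x < y

theorem largeIncreasing_concat (p : List ℕ) (x : ℕ) :
    LargeIncreasing (p ++ [x]) ↔ LargeIncreasing p ∧ (2 ≤ x → ∀ y ∈ p, y < x) := by
  simp only [LargeIncreasing, List.pairwise_append, List.pairwise_singleton, List.mem_singleton,
    forall_eq, true_and]
  exact and_congr_right fun _ => ⟨fun h hx y hy => h y hy hx, fun h y hy hx => h hx y hy⟩

theorem LargeIncreasing.avoids {p : List ℕ} (h : LargeIncreasing p) :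
    Avoids p [0, 1, 2, 2] ∧ Avoids p [1, 0, 3, 2] := by
  rw [LargeIncreasing, List.pairwise_iff_get] at h
  constructor
  · rintro ⟨f, hf, hfp⟩
    have h01 := (hfp 0 1).1
    have h12 := (hfp 1 2).1
    have h32 := (hfp 2 3).1
    have h23 := (hfp 2 3).2
    have := h (f 2) (f 3) (hf (by decide))
    simp at h01 h12 h23 h32 this
    omega
  · rintro ⟨f, hf, hfp⟩
    have h01 := (hfp 1 0).1
    have h12 := (hfp 0 3).1
    have h23 := (hfp 2 3).2
    have := h (f 2) (f 3) (hf (by decide))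
    simp at h01 h12 h23 this
    omega

theorem contains_0122_of_sublist {p : List ℕ} {a b c : ℕ} (hab : a < b) (hbc : b < c)
    (h : [a, b, c, c].Sublist p) : Contains p [0, 1, 2, 2] := by
  obtain ⟨f, hf⟩ := List.sublist_iff_exists_fin_orderEmbedding_get_eq.mp h
  refine ⟨f, f.strictMono, fun i j => ?_⟩
  have hi := hf i
  have hj := hf j
  rw [← hi, ← hj]
  clear hi hj hf
  change Fin 4 at i j
  fin_cases i <;> fin_cases j <;> simp <;> omega

theorem contains_1032_of_sublist {p : List ℕ} {a b c d : ℕ} (hab : a < b) (hbc : b < c)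
    (hcd : c < d) (h : [b, a, d, c].Sublist p) : Contains p [1, 0, 3, 2] := by
  obtain ⟨f, hf⟩ := List.sublist_iff_exists_fin_orderEmbedding_get_eq.mp h
  refine ⟨f, f.strictMono, fun i j => ?_⟩
  have hi := hf i
  have hj := hf j
  rw [← hi, ← hj]
  clear hi hj hf
  change Fin 4 at i j
  fin_cases i <;> fin_cases j <;> simp <;> omega

theorem Avoids.of_sublist {p q τ : List ℕ} (hpq : p.Sublist q) (h : Avoids q τ) :
    Avoids p τ := by
  rintro ⟨f, hf, hfp⟩
  obtain ⟨g, hg⟩ := List.sublist_iff_exists_fin_orderEmbedding_get_eq.mp hpq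
  refine h ⟨g ∘ f, g.strictMono.comp hf, fun i j => ?_⟩
  simpa only [Function.comp, ← hg] using hfp i j

theorem IsAscentSeq.zero_mem {p : List ℕ} (h : IsAscentSeq p) : 0 ∈ p :=
  List.mem_of_mem_head? (by rw [h.1]; rfl)

theorem IsAscentSeq.zero_one_sublist {p : List ℕ} (h : IsAscentSeq p) (ha : 1 ≤ numAscents p) :
    [0, 1].Sublist p := by
  induction p using List.reverseRecOn with
  | nil => simp [numAscents] at ha
  | append_singleton p x ih =>
    rcases eq_or_ne p [] with rfl | hp
    · simp [numAscents] at ha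
    rw [isAscentSeq_concat hp] at h
    rw [numAscents_concat hp] at ha
    rcases Nat.eq_zero_or_pos (numAscents p) with h0 | h0
    · obtain rfl : x = 1 := by
        split_ifs at ha <;> omega
      exact (List.singleton_sublist.mpr h.1.zero_mem).append (List.Sublist.refl [1])
    · exact (ih h.1 h0).trans (List.sublist_append_left _ _)

theorem mem_of_le_numAscents {p : List ℕ} (h : IsAscentSeq p) (hinc : LargeIncreasing p)
    (h10 : ¬ [1, 0].Sublist p) {v : ℕ} (hv : v ≤ numAscents p) : v ∈ p := by
  induction p using List.reverseRecOn generalizing v with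
  | nil => exact absurd rfl h.ne_nil
  | append_singleton p x ih =>
    rcases eq_or_ne p [] with rfl | hp
    · rw [List.nil_append, isAscentSeq_singleton] at h
      simp [numAscents] at hv
      simp [h, hv]
    rw [isAscentSeq_concat hp] at h
    rw [largeIncreasing_concat] at hinc
    rw [numAscents_concat hp] at hv
    have ih' := fun {v} => @ih h.1 hinc.1
      (fun hs => h10 (hs.trans (List.sublist_append_left _ _))) v
    by_cases hle : v ≤ numAscents p
    · exact List.mem_append_left _ (ih' hle)
    split_ifs at hv with hlast
    · by_contra hmem
      have hxv : x ≠ v := by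
        rintro rfl
        simp at hmem
      have hxp : x ∈ p := ih' (by omega)
      have hx1 : x = 1 := by
        by_contra hx1
        exact lt_irrefl x (hinc.2 (by omega) x hxp)
      subst hx1
      obtain ⟨q, y, rfl⟩ : ∃ q y, p = q ++ [y] :=
        ⟨p.dropLast, p.getLast hp, (List.dropLast_append_getLast hp).symm⟩
      obtain rfl : y = 0 := by simpa using hlast
      have h1q : 1 ∈ q := by simpa using hxp
      exact h10 (((List.singleton_sublist.mpr h1q).append (List.Sublist.refl [0])).trans
        (List.sublist_append_left _ _))
    · omega

theorem IsAscentSeq.largeIncreasing {p : List ℕ} (h : IsAscentSeq p)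
    (h1 : Avoids p [0, 1, 2, 2]) (h2 : Avoids p [1, 0, 3, 2]) : LargeIncreasing p := by
  induction p using List.reverseRecOn with
  | nil => exact List.Pairwise.nil
  | append_singleton p x ih =>
    rcases eq_or_ne p [] with rfl | hp
    · exact List.pairwise_singleton _ _
    have hasc := h
    rw [isAscentSeq_concat hp] at h
    have hinc := ih h.1 (h1.of_sublist (List.sublist_append_left _ _))
      (h2.of_sublist (List.sublist_append_left _ _))
    refine (largeIncreasing_concat _ _).mpr ⟨hinc, fun hx y hy => ?_⟩
    have hsplit : ∀ z ∈ p, 2 ≤ z → ∃ q r, p = q ++ z :: r ∧ IsAscentSeq q ∧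
        z ≤ numAscents q + 1 := by
      intro z hz hz2
      obtain ⟨q, r, rfl⟩ := List.append_of_mem hz
      have hqz : IsAscentSeq (q ++ [z]) :=
        IsAscentSeq.of_append (q := r) (by simp) (by simpa using h.1)
      rcases eq_or_ne q [] with rfl | hq
      · rw [List.nil_append, isAscentSeq_singleton] at hqz
        omega
      · exact ⟨q, r, rfl, (isAscentSeq_concat hq z).mp hqz⟩
    have hxp : x ∉ p := by
      intro hxp
      obtain ⟨q, r, rfl, hq, hxq⟩ := hsplit x hxp hx
      refine h1 (contains_0122_of_sublist Nat.zero_lt_one hx ?_)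
      exact ((hq.zero_one_sublist (by omega)).append
        (List.singleton_sublist.mpr List.mem_cons_self)).append (List.Sublist.refl [x])
    by_contra! hxy
    have hlt : x < y := lt_of_le_of_ne hxy fun e => hxp (e ▸ hy)
    obtain ⟨q, r, rfl, hq, hyq⟩ := hsplit y hy (by omega)
    by_cases h10 : [1, 0].Sublist q
    · refine h2 (contains_1032_of_sublist Nat.zero_lt_one hx hlt ?_)
      exact (h10.append (List.singleton_sublist.mpr List.mem_cons_self)).append
        (List.Sublist.refl [x])
    · exact hxp (List.mem_append_left _ (mem_of_le_numAscents hq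
        (List.pairwise_append.mp hinc).1 h10 (by omega)))

/-- Ascent sequences whose entries that are at least `2` are increasing. -/
def IsLargeIncreasingAscentSeq (p : List ℕ) : Prop := IsAscentSeq p ∧ LargeIncreasing p

theorem isLargeIncreasingAscentSeq_iff (p : List ℕ) :
    IsLargeIncreasingAscentSeq p ↔
      IsAscentSeq p ∧ ∀ τ ∈ [[0, 1, 2, 2], [1, 0, 3, 2]], Avoids p τ := by
  simp only [List.mem_cons, List.not_mem_nil, or_false, forall_eq_or_imp, forall_eq]
  exact and_congr_right fun h => ⟨fun h' => h'.avoids, fun h' => h.largeIncreasing h'.1 h'.2⟩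

theorem IsLargeIncreasingAscentSeq.of_append {p q : List ℕ} (hp : p ≠ [])
    (h : IsLargeIncreasingAscentSeq (p ++ q)) : IsLargeIncreasingAscentSeq p :=
  ⟨h.1.of_append hp, (List.pairwise_append.mp h.2).1⟩

/-- The entries that may follow a word with `a` ascents and largest entry `M` (or `M = 1`). -/
def nextEntries (a M : ℕ) : Finset ℕ := insert 0 (insert 1 (Finset.Ioc M (a + 1)))

theorem isLargeIncreasingAscentSeq_concat {p : List ℕ} (hp : IsLargeIncreasingAscentSeq p)
    (x : ℕ) : IsLargeIncreasingAscentSeq (p ++ [x]) ↔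
      x ∈ nextEntries (numAscents p) (p.foldr max 1) := by
  have hmax : (∀ y ∈ p, y < x) ∧ 1 < x ↔ p.foldr max 1 < x := by
    clear hp
    induction p with
    | nil => simp
    | cons a l ih => simp [← ih, and_assoc]
  rw [IsLargeIncreasingAscentSeq, isAscentSeq_concat hp.1.ne_nil, largeIncreasing_concat]
  simp only [hp.1, hp.2, true_and, nextEntries, Finset.mem_insert, Finset.mem_Ioc, ← hmax]
  constructor
  · rintro ⟨h1, h2⟩
    by_cases hx : 2 ≤ x
    · exact Or.inr (Or.inr ⟨⟨h2 hx, hx⟩, h1⟩)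
    · omega
  · rintro (rfl | rfl | ⟨⟨h1, h2⟩, h3⟩)
    · simp
    · simp
    · exact ⟨h3, fun _ => h1⟩

/-- The words of length `m` that extend a word with last entry `l`, `a` ascents and largest
entry `M` (or `M = 1`). -/
def extensions : ℕ → ℕ → ℕ → ℕ → Finset (List ℕ)
  | 0, _, _, _ => {[]}
  | m + 1, l, a, M => (nextEntries a M).biUnion fun x =>
      (extensions m x (a + if l < x then 1 else 0) (max M x)).map
        ⟨List.cons x, List.cons_injective⟩

theorem mem_extensions (m : ℕ) (p w : List ℕ) (hp : IsLargeIncreasingAscentSeq p) :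
    w ∈ extensions m (p.getLastD 0) (numAscents p) (p.foldr max 1) ↔
      w.length = m ∧ IsLargeIncreasingAscentSeq (p ++ w) := by
  induction m generalizing p w with
  | zero =>
    simp only [extensions, Finset.mem_singleton, List.length_eq_zero_iff]
    exact ⟨by rintro rfl; simpa using hp, fun h => h.1⟩
  | succ m ih =>
    have hmax : ∀ x, (p ++ [x]).foldr max 1 = max (p.foldr max 1) x := by
      intro x
      clear hp ih
      induction p with
      | nil => simp [max_comm]
      | cons a l ih => simp only [List.cons_append, List.foldr_cons, ih, max_assoc]
    have key : ∀ x u, x ∈ nextEntries (numAscents p) (p.foldr max 1) →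
        (u ∈ extensions m x (numAscents p + if p.getLastD 0 < x then 1 else 0)
          (max (p.foldr max 1) x) ↔ u.length = m ∧ IsLargeIncreasingAscentSeq (p ++ x :: u)) := by
      intro x u hx
      have := ih (p ++ [x]) u ((isLargeIncreasingAscentSeq_concat hp x).mpr hx)
      simpa [hmax, numAscents_concat hp.1.ne_nil] using this
    simp only [extensions, Finset.mem_biUnion, Finset.mem_map, Function.Embedding.coeFn_mk]
    constructor
    · rintro ⟨x, hx, u, hu, rfl⟩
      rw [key x u hx] at hu
      simpa using hu
    · rcases w with _ | ⟨x, u⟩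
      · simp
      · rintro ⟨hlen, h⟩
        have hx : x ∈ nextEntries (numAscents p) (p.foldr max 1) := by
          rw [← isLargeIncreasingAscentSeq_concat hp]
          exact IsLargeIncreasingAscentSeq.of_append (q := u) (by simp) (by simpa using h)
        exact ⟨x, hx, u, (key x u hx).mpr ⟨by simpa using hlen, h⟩, rfl⟩

theorem card_extensions_succ (m l s N : ℕ) (hl : l ≤ N + 1) :
    (extensions (m + 1) l (N + s) (N + 1)).card =
      (extensions m 0 (N + s) (N + 1)).card +
        ((extensions m 1 (N + s + if l = 0 then 1 else 0) (N + 1)).card +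
          ∑ i ∈ Finset.range s, (extensions m (N + s + 1 - i) (N + s + 1) (N + s + 1 - i)).card) := by
  rw [extensions, Finset.card_biUnion, nextEntries, Finset.sum_insert (by simp),
    Finset.sum_insert (by simp)]
  · simp only [Finset.card_map, Nat.not_lt_zero, if_false, Nat.add_zero, Nat.lt_one_iff]
    congr 2
    · simp
    · refine Finset.sum_bij' (fun x _ => N + s + 1 - x) (fun i _ => N + s + 1 - i) ?_ ?_ ?_ ?_ ?_
      · intro x hx
        simp at hx ⊢
        omega
      · intro x hx
        simp at hx ⊢
        omega
      · intro x hx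
        simp at hx ⊢
        omega
      · intro x hx
        simp at hx ⊢
        omega
      · intro x hx
        rw [Finset.mem_Ioc] at hx
        rw [if_pos (by omega), max_eq_right (by omega), Nat.sub_sub_self (by omega)]
  · intro x _ y _ hxy
    rw [Function.onFun, Finset.disjoint_left]
    intro w hw hw'
    simp only [Finset.mem_map, Function.Embedding.coeFn_mk] at hw hw'
    obtain ⟨u, _, rfl⟩ := hw
    obtain ⟨v, _, hv⟩ := hw'
    exact hxy (List.cons.inj hv).1.symm

theorem card_extensions (m : ℕ) :
    (∀ N s, ((extensions m 0 (N + s) (N + 1)).card : ℤ) =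
      PowerSeries.coeff m (catalanGF ^ 2 * slackRatio ^ s)) ∧
    ∀ N s l, l ≠ 0 → l ≤ N + 1 → ((extensions m l (N + (s + 1)) (N + 1)).card : ℤ) =
      PowerSeries.coeff m (catalanGF ^ 3 * slackRatio ^ s) := by
  induction m with
  | zero => simp [extensions, slackRatio, catalanGF]
  | succ m ih =>
    obtain ⟨ihZ, ihN⟩ := ih
    have hsum : ∀ N s, ∑ i ∈ Finset.range s,
        ((extensions m (N + s + 1 - i) (N + s + 1) (N + s + 1 - i)).card : ℤ) =
        PowerSeries.coeff m (∑ i ∈ Finset.range s, catalanGF ^ 3 * slackRatio ^ i) := by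
      intro N s
      rw [map_sum]
      refine Finset.sum_congr rfl fun i hi => ?_
      rw [Finset.mem_range] at hi
      have := ihN (N + s - i) i (N + s + 1 - i) (by omega) (by omega)
      rwa [show N + s - i + (i + 1) = N + s + 1 by omega,
        show N + s - i + 1 = N + s + 1 - i by omega] at this
    constructor
    · intro N s
      rw [card_extensions_succ _ _ _ _ (Nat.zero_le _), zeroEnding_series_eq]
      push_cast
      rw [hsum, ihZ, Nat.add_assoc N s 1, ihN N s 1 one_ne_zero (by omega)]
      simp [PowerSeries.coeff_succ_X_mul, PowerSeries.coeff_one]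
    · intro N s l hl hlN
      rw [card_extensions_succ _ _ _ _ hlN, nonzeroEnding_series_eq]
      push_cast
      rw [hsum, ihZ, if_neg hl, Nat.add_zero (N + (s + 1)), ihN N s 1 one_ne_zero (by omega)]
      simp [PowerSeries.coeff_succ_X_mul, PowerSeries.coeff_one]

end Words

/-- The number of ascent sequences of length `n` avoiding both patterns equals
the Catalan number $C_n$. -/
theorem catalan_count_avoid_0122_1032 (n : ℕ) (hn : 1 ≤ n) :
    avoiderCount n [[0,1,2,2], [1,0,3,2]] = catalan n := by
  obtain ⟨m, rfl⟩ : ∃ m, n = m + 1 := ⟨n - 1, by omega⟩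
  have h0 : IsLargeIncreasingAscentSeq [0] :=
    ⟨(isAscentSeq_singleton 0).mpr rfl, List.pairwise_singleton _ _⟩
  have hset : {w : List ℕ | w.length = m + 1 ∧ IsAscentSeq w ∧
      ∀ τ ∈ [[0, 1, 2, 2], [1, 0, 3, 2]], Avoids w τ} =
      ((extensions m 0 0 1).map ⟨List.cons 0, List.cons_injective⟩ : Finset (List ℕ)) := by
    ext w
    have hmem := fun u => mem_extensions m [0] u h0
    have hasc : numAscents [0] = 0 := rfl
    simp only [hasc, List.getLastD_cons, List.getLastD_nil, List.foldr_cons, List.foldr_nil,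
      zero_le, sup_of_le_right, List.singleton_append] at hmem
    simp only [← isLargeIncreasingAscentSeq_iff, Set.mem_ofPred_eq, Finset.coe_map, Set.mem_image,
      Finset.mem_coe, Function.Embedding.coeFn_mk, hmem]
    constructor
    · rintro ⟨hlen, h⟩
      rcases w with _ | ⟨x, u⟩
      · simp at hlen
      · obtain rfl : x = 0 := by simpa using h.1.1
        exact ⟨u, ⟨by simpa using hlen, h⟩, rfl⟩
    · rintro ⟨u, ⟨hlen, h⟩, rfl⟩
      exact ⟨by simpa using hlen, h⟩
  rw [avoiderCount, hset, Set.ncard_coe_finset, Finset.card_map]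
  have := (card_extensions m).1 0 0
  rw [pow_zero, mul_one, coeff_catalanGF_sq] at this
  exact_mod_cast this
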